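/- arXiv:2107.09417 — 3 statements merged into one kernel-verified Lean document; each statement's English description precedes it below -/
import Mathlib

section
/- Let C be a maximal configuration on an m × n tract of land with m ≥ 2. If a bottom-row lot (m,j) is empty (i.e. (m,j) ∉ C), then the three lots (m-1,j-1), (m-1,j) and (m-1,j+1) all exist and all belong to C. -/
/-- The `m × n` tract of land, 0-indexed: lot `(i, j)` with `i < m` (row, from the north/top)
and `j < n` (column, from the west). -/
def grid (m n : ℕ) : Finset (ℕ × ℕ) := Finset.range m ×ˢ Finset.range n

/-- A house at `p = (i, j)` is blocked (w.r.t. configuration `C`) if its west, east and south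
neighbours `(i, j-1)`, `(i, j+1)`, `(i+1, j)` all exist and lie in `C`.  (For `C ⊆ grid m n`,
membership in `C` already guarantees existence; only `j - 1` needs the guard `1 ≤ j`.) -/
def Blocked (C : Finset (ℕ × ℕ)) (p : ℕ × ℕ) : Prop :=
  1 ≤ p.2 ∧ (p.1, p.2 - 1) ∈ C ∧ (p.1, p.2 + 1) ∈ C ∧ (p.1 + 1, p.2) ∈ C

/-- A configuration on the `m × n` tract is permissible if it consists of lots of the tract
and no house in it is blocked. -/
def Permissible (m n : ℕ) (C : Finset (ℕ × ℕ)) : Prop :=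
  C ⊆ grid m n ∧ ∀ p ∈ C, ¬ Blocked C p

/-- A configuration is maximal if it is permissible and adding a house on any empty lot
yields an impermissible configuration. -/
def MaximalConfig (m n : ℕ) (C : Finset (ℕ × ℕ)) : Prop :=
  Permissible m n C ∧ ∀ p ∈ grid m n, p ∉ C → ¬ Permissible m n (insert p C)

/-- If a bottom-row lot of a maximal configuration (with `m ≥ 2`) is empty, then the three
lots to the north-west, north and north-east of it all exist and belong to `C`. -/
theorem stmt_4 (m n : ℕ) (hm : 2 ≤ m) (C : Finset (ℕ × ℕ)) (hC : MaximalConfig m n C)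
    (j : ℕ) (hj : j < n) (hempty : (m - 1, j) ∉ C) :
    1 ≤ j ∧ j + 1 < n ∧
      (m - 2, j - 1) ∈ C ∧ (m - 2, j) ∈ C ∧ (m - 2, j + 1) ∈ C := by
  obtain ⟨⟨hsub, hperm⟩, hmax⟩ := hC
  have hg : ∀ a b, (a, b) ∈ C → a < m ∧ b < n := by
    intro a b h
    simpa [grid] using hsub h
  have hp : (m - 1, j) ∈ grid m n := by
    simp only [grid, Finset.mem_product, Finset.mem_range]
    omega
  have hnot := hmax _ hp hempty
  have hex : ∃ p ∈ insert (m - 1, j) C, Blocked (insert (m - 1, j) C) p := by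
    by_contra hcon
    push Not at hcon
    exact hnot ⟨Finset.insert_subset hp hsub, hcon⟩
  obtain ⟨⟨a, b⟩, hmem, hb, hw, he, hs⟩ := hex
  simp only [Finset.mem_insert, Prod.mk.injEq] at hmem hb hw he hs
  have ha : a + 1 < m := by
    rcases hs with hs | hs
    · omega
    · exact (hg _ _ hs).1
  have hmem' : (a, b) ∈ C := hmem.resolve_left (by omega)
  have hw' : (a, b - 1) ∈ C := hw.resolve_left (by omega)
  have he' : (a, b + 1) ∈ C := he.resolve_left (by omega)
  rcases hs with ⟨h1, h2⟩ | hs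
  · subst h2
    have h3 : m - 2 = a := by omega
    rw [h3]
    exact ⟨hb, (hg _ _ he').2, hw', hmem', he'⟩
  · exact absurd ⟨hb, hw', he', hs⟩ (hperm _ hmem')
end

section
/- Every maximal configuration on a 3 × 3 tract of land has occupancy (cardinality) either 7 or 8; exactly one element of M_{3,3} has occupancy 8, and exactly nine elements have occupancy 7. -/
instance (C : Finset (ℕ × ℕ)) (p : ℕ × ℕ) : Decidable (Blocked C p) := by
  unfold Blocked; infer_instance

instance (m n : ℕ) (C : Finset (ℕ × ℕ)) : Decidable (Permissible m n C) := by
  unfold Permissible; infer_instance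

instance (m n : ℕ) (C : Finset (ℕ × ℕ)) : Decidable (MaximalConfig m n C) := by
  unfold MaximalConfig; infer_instance

/-- The lot `(0, 1)` together with its three neighbours. -/
def zoneA : Finset (ℕ × ℕ) := {(0, 0), (0, 1), (0, 2), (1, 1)}

/-- The lot `(1, 1)` together with its three neighbours. -/
def zoneB : Finset (ℕ × ℕ) := {(1, 0), (1, 1), (1, 2), (2, 1)}

theorem permissible_iff (C : Finset (ℕ × ℕ)) :
    Permissible 3 3 C ↔ C ⊆ grid 3 3 ∧ ¬ zoneA ⊆ C ∧ ¬ zoneB ⊆ C := by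
  constructor
  · rintro ⟨h, hb⟩
    refine ⟨h, fun hA => hb (0, 1) (hA (by decide)) ?_, fun hB => hb (1, 1) (hB (by decide)) ?_⟩
    · exact ⟨le_refl _, hA (by decide), hA (by decide), hA (by decide)⟩
    · exact ⟨le_refl _, hB (by decide), hB (by decide), hB (by decide)⟩
  · rintro ⟨h, hA, hB⟩
    refine ⟨h, ?_⟩
    rintro ⟨i, j⟩ hp ⟨h1, hw, he, hs⟩
    have h2 := h he
    have h3 := h hs
    simp only [grid, Finset.mem_product, Finset.mem_range] at h1 h2 h3
    obtain rfl : j = 1 := by omega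
    have hi : i = 0 ∨ i = 1 := by omega
    rcases hi with rfl | rfl
    · apply hA
      simp only [zoneA, Finset.insert_subset_iff, Finset.singleton_subset_iff]
      exact ⟨hw, hp, he, hs⟩
    · apply hB
      simp only [zoneB, Finset.insert_subset_iff, Finset.singleton_subset_iff]
      exact ⟨hw, hp, he, hs⟩

theorem eq_of_missing {C : Finset (ℕ × ℕ)} (h : MaximalConfig 3 3 C) {x y : ℕ × ℕ}
    (hx : x ∈ zoneA) (hy : y ∈ zoneB) (hxC : x ∉ C) (hyC : y ∉ C) :
    C = grid 3 3 \ {x, y} := by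
  ext p
  simp only [Finset.mem_sdiff, Finset.mem_insert, Finset.mem_singleton, not_or]
  constructor
  · intro hp
    refine ⟨h.1.1 hp, ?_, ?_⟩ <;> rintro rfl <;> contradiction
  · rintro ⟨hp, hpx, hpy⟩
    by_contra hpC
    refine h.2 p hp hpC ((permissible_iff _).2 ⟨?_, fun hA => ?_, fun hB => ?_⟩)
    · exact Finset.insert_subset hp h.1.1
    · rcases Finset.mem_insert.1 (hA hx) with e | e
      · exact hpx e.symm
      · exact hxC e
    · rcases Finset.mem_insert.1 (hB hy) with e | e
      · exact hpy e.symm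
      · exact hyC e

/-- Pairs of (possibly equal) empty lots describing the maximal configurations. -/
def emptyPairs : Finset ((ℕ × ℕ) × (ℕ × ℕ)) :=
  insert ((1, 1), (1, 1)) ((zoneA.erase (1, 1)) ×ˢ (zoneB.erase (1, 1)))

/-- The maximal configurations on the `3 × 3` tract. -/
def maxConfigs : Finset (Finset (ℕ × ℕ)) :=
  emptyPairs.image (fun q => grid 3 3 \ {q.1, q.2})

theorem maximalConfig_iff (C : Finset (ℕ × ℕ)) : MaximalConfig 3 3 C ↔ C ∈ maxConfigs := by
  constructor
  · intro h
    refine Finset.mem_image.2 ?_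
    by_cases hc : (1, 1) ∈ C
    · obtain ⟨-, hA, hB⟩ := (permissible_iff C).1 h.1
      obtain ⟨x, hx, hxC⟩ := Finset.not_subset.1 hA
      obtain ⟨y, hy, hyC⟩ := Finset.not_subset.1 hB
      refine ⟨(x, y), Finset.mem_insert_of_mem (Finset.mem_product.2
        ⟨Finset.mem_erase.2 ⟨?_, hx⟩, Finset.mem_erase.2 ⟨?_, hy⟩⟩),
        (eq_of_missing h hx hy hxC hyC).symm⟩
      · rintro rfl
        exact hxC hc
      · rintro rfl
        exact hyC hc
    · exact ⟨((1, 1), (1, 1)), Finset.mem_insert_self _ _,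
        (eq_of_missing h (by decide) (by decide) hc hc).symm⟩
  · have key : ∀ C ∈ maxConfigs, MaximalConfig 3 3 C := by decide +kernel
    exact key C

theorem ncard_eq (k : ℕ) : {C : Finset (ℕ × ℕ) | MaximalConfig 3 3 C ∧ C.card = k}.ncard =
    (maxConfigs.filter (fun C => C.card = k)).card := by
  rw [← Set.ncard_coe_finset]
  congr 1
  ext C
  simp only [Set.mem_ofPred_eq, Finset.coe_filter, maximalConfig_iff]

theorem card_cases : ∀ C ∈ maxConfigs, C.card = 7 ∨ C.card = 8 := by
  decide +kernel

theorem count_eight : (maxConfigs.filter (fun C => C.card = 8)).card = 1 := by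
  decide +kernel

theorem count_seven : (maxConfigs.filter (fun C => C.card = 7)).card = 9 := by
  decide +kernel

/-- Every maximal configuration on a 3 × 3 tract has occupancy 7 or 8; exactly one has
occupancy 8 and exactly nine have occupancy 7. -/
theorem stmt_8 :
    (∀ C : Finset (ℕ × ℕ), MaximalConfig 3 3 C → C.card = 7 ∨ C.card = 8) ∧
    {C : Finset (ℕ × ℕ) | MaximalConfig 3 3 C ∧ C.card = 8}.ncard = 1 ∧
    {C : Finset (ℕ × ℕ) | MaximalConfig 3 3 C ∧ C.card = 7}.ncard = 9 := by
  refine ⟨fun C h => card_cases C ((maximalConfig_iff C).1 h), ?_, ?_⟩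
  · rw [ncard_eq, count_eight]
  · rw [ncard_eq, count_seven]
end

section
/- There are exactly 19 maximal configurations on a 3 × 4 tract of land and exactly 25 maximal configurations on a 4 × 3 tract of land; in particular |M_{3,4}| ≠ |M_{4,3}|, so the orientation of the tract of land matters. -/
/-- Decode a bitmask `k` into a configuration: lot `(i, j)` is bit `n * i + j`. -/
def dec (m n k : ℕ) : Finset (ℕ × ℕ) :=
  (grid m n).filter (fun p => k.testBit (n * p.1 + p.2) = true)

/-- Lot `(i, 1)`-type blocking pattern, for the house at bit `b` in a tract with `n` columns. -/
def blk (n k b : ℕ) : Bool :=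
  k.testBit b && k.testBit (b - 1) && k.testBit (b + 1) && k.testBit (b + n)

/-- Permissibility on bitmasks, `l` listing the lots that could be blocked. -/
def permB (n : ℕ) (l : List ℕ) (k : ℕ) : Bool := l.all (fun b => !blk n k b)

/-- Maximality on bitmasks with 12 lots. -/
def maxB (n : ℕ) (l : List ℕ) (k : ℕ) : Bool :=
  permB n l k && (List.range 12).all (fun b => k.testBit b || !permB n l (k ||| 2 ^ b))

/-- Number of `x` in the block of `2 ^ d` numbers starting at `2 ^ d * k` satisfying `f`. -/
def cnt (f : ℕ → Bool) : ℕ → ℕ → ℕ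
  | 0, k => cond (f k) 1 0
  | d + 1, k => cnt f d (2 * k) + cnt f d (2 * k + 1)

theorem cnt_eq (f : ℕ → Bool) (d k : ℕ) :
    cnt f d k = ((Finset.Ico (2 ^ d * k) (2 ^ d * (k + 1))).filter (fun x => f x = true)).card := by
  induction d generalizing k with
  | zero =>
    have : Finset.Ico (2 ^ 0 * k) (2 ^ 0 * (k + 1)) = {k} := by ext; simp
    rw [this, Finset.filter_singleton]
    cases h : f k <;> simp [cnt, h]
  | succ d ih =>
    rw [cnt, ih, ih, ← Finset.card_union_of_disjoint, ← Finset.filter_union,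
      Finset.Ico_union_Ico_eq_Ico]
    · congr 3 <;> ring
    · gcongr; omega
    · gcongr; omega
    · apply Finset.disjoint_filter_filter
      exact Finset.Ico_disjoint_Ico_consecutive _ _ _

theorem dec_surj (m n : ℕ) (C : Finset (ℕ × ℕ)) (h : C ⊆ grid m n) :
    ∃ k < 2 ^ (m * n), dec m n k = C := by
  refine ⟨Nat.ofBits (fun i : Fin (m * n) => decide ((i.1 / n, i.1 % n) ∈ C)),
    Nat.ofBits_lt_two_pow _, ?_⟩
  ext ⟨i, j⟩
  have key : (i, j) ∈ grid m n → n * i + j < m * n ∧ (n * i + j) / n = i ∧ (n * i + j) % n = j := by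
    simp only [grid, Finset.mem_product, Finset.mem_range]
    rintro ⟨hi, hj⟩
    refine ⟨by nlinarith, ?_, ?_⟩
    · rw [Nat.mul_add_div (by omega), Nat.div_eq_of_lt hj]; rfl
    · rw [Nat.mul_add_mod, Nat.mod_eq_of_lt hj]
  simp only [dec, Finset.mem_filter]
  constructor
  · rintro ⟨h1, h2⟩
    obtain ⟨h3, h4, h5⟩ := key h1
    rw [Nat.testBit_ofBits_lt _ _ h3] at h2
    simpa [h4, h5] using h2
  · intro h1
    obtain ⟨h3, h4, h5⟩ := key (h h1)
    refine ⟨h h1, ?_⟩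
    rw [Nat.testBit_ofBits_lt _ _ h3]
    simpa [h4, h5] using h1

theorem dec_inj (m n k k' : ℕ) (hk : k < 2 ^ (m * n)) (hk' : k' < 2 ^ (m * n))
    (h : dec m n k = dec m n k') : k = k' := by
  apply Nat.eq_of_testBit_eq
  intro i
  by_cases hi : i < m * n
  · have hn : 0 < n := Nat.pos_of_ne_zero (by rintro rfl; simp at hi)
    have h1 := Finset.ext_iff.1 h (i / n, i % n)
    have h2 : (i / n, i % n) ∈ grid m n := by
      simp only [grid, Finset.mem_product, Finset.mem_range]
      exact ⟨by rw [Nat.div_lt_iff_lt_mul hn]; exact hi, Nat.mod_lt _ hn⟩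
    simp only [dec, Finset.mem_filter, h2, true_and, Nat.div_add_mod] at h1
    exact Bool.eq_iff_iff.2 h1
  · have : 2 ^ (m * n) ≤ 2 ^ i := Nat.pow_le_pow_right (by norm_num) (by omega)
    rw [Nat.testBit_lt_two_pow (by omega), Nat.testBit_lt_two_pow (by omega)]

theorem dec_insert (m n k i j : ℕ) (h : (i, j) ∈ grid m n) :
    dec m n (k ||| 2 ^ (n * i + j)) = insert (i, j) (dec m n k) := by
  ext ⟨a, b⟩
  simp only [dec, Finset.mem_filter, Finset.mem_insert, Nat.testBit_or, Nat.testBit_two_pow,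
    Bool.or_eq_true, decide_eq_true_eq, Prod.mk.injEq]
  constructor
  · rintro ⟨h1, h2 | h2⟩
    · exact Or.inr ⟨h1, h2⟩
    · left
      simp only [grid, Finset.mem_product, Finset.mem_range] at h h1
      have e1 := congrArg (· / n) h2
      have e2 := congrArg (· % n) h2
      simp only [Nat.mul_add_mod, Nat.mul_add_div (show 0 < n by omega), Nat.mod_eq_of_lt h.2,
        Nat.mod_eq_of_lt h1.2, Nat.div_eq_of_lt h.2, Nat.div_eq_of_lt h1.2] at e1 e2
      omega
  · rintro (⟨rfl, rfl⟩ | ⟨h1, h2⟩)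
    · exact ⟨h, Or.inr rfl⟩
    · exact ⟨h1, Or.inl h2⟩

theorem max_iff (m n : ℕ) (l : List ℕ) (hmn : m * n = 12)
    (hp : ∀ k, Permissible m n (dec m n k) ↔ permB n l k = true) (k : ℕ) :
    MaximalConfig m n (dec m n k) ↔ maxB n l k = true := by
  have hn : 0 < n := Nat.pos_of_ne_zero (by rintro rfl; simp at hmn)
  simp only [MaximalConfig, maxB, Bool.and_eq_true, hp, List.all_eq_true, List.mem_range,
    Bool.or_eq_true, Bool.not_eq_true']
  refine and_congr_right fun _ => ⟨fun h b hb => ?_, ?_⟩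
  · have h2 : (b / n, b % n) ∈ grid m n := by
      simp only [grid, Finset.mem_product, Finset.mem_range]
      exact ⟨by rw [Nat.div_lt_iff_lt_mul hn]; omega, Nat.mod_lt _ hn⟩
    by_cases hc : k.testBit b = true
    · exact Or.inl hc
    · right
      have := h _ h2 (by simp only [dec, Finset.mem_filter, Nat.div_add_mod]; tauto)
      rw [← dec_insert _ _ _ _ _ h2, hp, Nat.div_add_mod] at this
      simpa using this
  · rintro h ⟨i, j⟩ hg hc
    rw [← dec_insert _ _ _ _ _ hg, hp]
    have hlt : n * i + j < 12 := by
      simp only [grid, Finset.mem_product, Finset.mem_range] at hg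
      nlinarith
    rcases h _ hlt with h1 | h1
    · exact absurd (by simp only [dec, Finset.mem_filter]; exact ⟨hg, h1⟩) hc
    · simp [h1]

theorem card_eq (m n : ℕ) (l : List ℕ) (hmn : m * n = 12)
    (hp : ∀ k, Permissible m n (dec m n k) ↔ permB n l k = true) :
    {C : Finset (ℕ × ℕ) | MaximalConfig m n C}.ncard = cnt (maxB n l) 12 0 := by
  rw [cnt_eq]
  have : {C : Finset (ℕ × ℕ) | MaximalConfig m n C} =
      ((((Finset.Ico (2 ^ 12 * 0) (2 ^ 12 * (0 + 1))).filter
        (fun x => maxB n l x = true)).image (dec m n) : Finset _) : Set _) := by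
    ext C
    simp only [Set.mem_ofPred_eq, Finset.coe_image, Set.mem_image, Finset.mem_coe,
      Finset.mem_filter, Finset.mem_Ico]
    constructor
    · intro h
      obtain ⟨k, hk, rfl⟩ := dec_surj m n C h.1.1
      rw [hmn] at hk
      exact ⟨k, ⟨⟨by omega, by omega⟩, (max_iff m n l hmn hp k).1 h⟩, rfl⟩
    · rintro ⟨k, ⟨_, h⟩, rfl⟩
      exact (max_iff m n l hmn hp k).2 h
  rw [this, Set.ncard_coe_finset, Finset.card_image_of_injOn]
  intro x hx y hy hxy
  simp only [Finset.coe_filter, Finset.mem_Ico, Set.mem_ofPred_eq] at hx hy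
  exact dec_inj m n x y (by rw [hmn]; omega) (by rw [hmn]; omega) hxy

theorem perm34 (k : ℕ) : Permissible 3 4 (dec 3 4 k) ↔ permB 4 [1, 2, 5, 6] k = true := by
  simp only [Permissible, Blocked, dec, grid, permB, blk, Finset.filter_subset, true_and,
    Finset.mem_filter, Finset.mem_product, Finset.mem_range, Prod.forall]
  constructor
  · intro h
    have h1 := h 0 1
    have h2 := h 0 2
    have h3 := h 1 1
    have h4 := h 1 2
    clear h
    simp at h1 h2 h3 h4 ⊢
    grind
  · rintro h a b ⟨⟨ha, hb⟩, h1⟩ ⟨h2, ⟨_, h3⟩, ⟨⟨_, h4'⟩, h4⟩, ⟨⟨h5', _⟩, h5⟩⟩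
    simp at h
    have ha' : a < 2 := by omega
    have hb' : b < 3 := by omega
    interval_cases a <;> interval_cases b <;> simp_all

theorem perm43 (k : ℕ) : Permissible 4 3 (dec 4 3 k) ↔ permB 3 [1, 4, 7] k = true := by
  simp only [Permissible, Blocked, dec, grid, permB, blk, Finset.filter_subset, true_and,
    Finset.mem_filter, Finset.mem_product, Finset.mem_range, Prod.forall]
  constructor
  · intro h
    have h1 := h 0 1
    have h2 := h 1 1
    have h3 := h 2 1
    clear h
    simp at h1 h2 h3 ⊢
    grind
  · rintro h a b ⟨⟨ha, hb⟩, h1⟩ ⟨h2, ⟨_, h3⟩, ⟨⟨_, h4'⟩, h4⟩, ⟨⟨h5', _⟩, h5⟩⟩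
    simp at h
    have ha' : a < 3 := by omega
    have hb' : b < 2 := by omega
    interval_cases a <;> interval_cases b <;> simp_all

theorem cnt34 : cnt (maxB 4 [1, 2, 5, 6]) 12 0 = 19 := by decide +kernel

theorem cnt43 : cnt (maxB 3 [1, 4, 7]) 12 0 = 25 := by decide +kernel



/-- There are exactly 19 maximal configurations on a 3 × 4 tract and exactly 25 on a
4 × 3 tract; in particular the two counts differ, so orientation matters. -/
theorem stmt_9 :
    {C : Finset (ℕ × ℕ) | MaximalConfig 3 4 C}.ncard = 19 ∧
    {C : Finset (ℕ × ℕ) | MaximalConfig 4 3 C}.ncard = 25 ∧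
    {C : Finset (ℕ × ℕ) | MaximalConfig 3 4 C}.ncard ≠
      {C : Finset (ℕ × ℕ) | MaximalConfig 4 3 C}.ncard := by
  rw [card_eq 3 4 _ rfl perm34, card_eq 4 3 _ rfl perm43, cnt34, cnt43]
  decide
end
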